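/- Let (σ_i)_{i∈Π} be a secure equilibrium in a multiplayer quantitative reachability game (G, v₀), with outcome ρ. Suppose ρ = αβγρ̄, where β is nonempty, |γ| ≥ |V|, Visit(α) = Visit(αβγ), Visit(ρ) ≠ Visit(α), and last(α) = last(αβ). Then there exists a secure equilibrium (τ_i)_{i∈Π} in (G, v₀) with outcome αγρ̄. -/

import Mathlib

open scoped Classical ENat

/-- A multiplayer quantitative reachability game: a finite directed graph whose
vertices are partitioned among the players (via `owner`), every vertex has an
outgoing edge, and each player `i` has a nonempty goal set `F i`. -/
structure QRGame (ι V : Type) where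
  owner : V → ι
  E : V → V → Prop
  total : ∀ v, ∃ w, E v w
  F : ι → Set V
  F_ne : ∀ i, (F i).Nonempty

namespace QRGame

variable {ι V : Type}

/-- Histories are encoded as *reversed* nonempty lists: the head is the current
vertex, the last element is the initial vertex `v₀`, and consecutive elements
are joined by edges of the graph. -/
def IsHist (G : QRGame ι V) (v₀ : V) : List V → Prop
  | [] => False
  | [v] => v = v₀
  | v :: w :: t => G.E w v ∧ IsHist G v₀ (w :: t)

/-- The current (i.e. most recent) vertex of a history. -/
def cur (v₀ : V) (h : List V) : V := h.headD v₀

/-- `σ` is a valid strategy of player `i`: on every history whose current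
vertex belongs to player `i`, it chooses a successor along an edge. -/
def IsStrat (G : QRGame ι V) (v₀ : V) (i : ι) (σ : List V → V) : Prop :=
  ∀ h : List V, G.IsHist v₀ h → G.owner (cur v₀ h) = i → G.E (cur v₀ h) (σ h)

/-- A strategy profile: one valid strategy for each player. -/
def IsProfile (G : QRGame ι V) (v₀ : V) (σ : ι → List V → V) : Prop :=
  ∀ i, G.IsStrat v₀ i (σ i)

/-- The history reached after `n` further steps when all players follow the
profile `σ` from the history `h` on. -/
def histFrom (G : QRGame ι V) (v₀ : V) (σ : ι → List V → V) (h : List V) : ℕ → List V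
  | 0 => h
  | n + 1 =>
      σ (G.owner (cur v₀ (histFrom G v₀ σ h n))) (histFrom G v₀ σ h n)
        :: histFrom G v₀ σ h n

/-- The full play (indexed from time `0`) whose prefix is the history `h` and
which is consistent with the profile `σ` after `h`. -/
def fullPlay (G : QRGame ι V) (v₀ : V) (σ : ι → List V → V) (h : List V) (t : ℕ) : V :=
  (G.histFrom v₀ σ h t).reverse.getD t v₀

/-- The outcome `⟨(σ_i)⟩_{v₀}` of the profile `σ` from the initial vertex. -/
def outcome (G : QRGame ι V) (v₀ : V) (σ : ι → List V → V) : ℕ → V :=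
  G.fullPlay v₀ σ [v₀]

/-- Cost of player `i` for a play `ρ`: the least `l` with `ρ l ∈ F i`,
and `⊤` (i.e. `+∞`) if there is no such `l`. -/
noncomputable def cost (G : QRGame ι V) (i : ι) (ρ : ℕ → V) : ℕ∞ :=
  ⨅ l ∈ {l : ℕ | ρ l ∈ G.F i}, (l : ℕ∞)

/-- Cost of player `i` for the finite prefix `ρ₀ … ρ_{m-1}` of a play. -/
noncomputable def costLT (G : QRGame ι V) (i : ι) (ρ : ℕ → V) (m : ℕ) : ℕ∞ :=
  ⨅ l ∈ {l : ℕ | l < m ∧ ρ l ∈ G.F i}, (l : ℕ∞)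

end QRGame

/-- The preference relation `≺_j` of player `j` on cost profiles:
`x ≺_j y` iff `x j > y j`, or `x j = y j`, every player's cost does not
decrease, and some player's cost strictly increases. -/
def Prec {ι : Type} (j : ι) (x y : ι → ℕ∞) : Prop :=
  y j < x j ∨ (x j = y j ∧ (∀ i, x i ≤ y i) ∧ ∃ i, x i < y i)

namespace QRGame

variable {ι V : Type} [DecidableEq ι]

/-- `σ` restricted after the history `h` is a secure equilibrium in the subgame
`(G|_h, cur h)`: no player `j` has a `≺_j`-profitable deviation after `h`
(costs are computed on the whole play, including the prefix `h`). -/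
def IsSecureAfter (G : QRGame ι V) (v₀ : V) (σ : ι → List V → V) (h : List V) : Prop :=
  ¬ ∃ (j : ι) (σ' : List V → V), G.IsStrat v₀ j σ' ∧
      Prec j (fun i => G.cost i (G.fullPlay v₀ σ h))
        (fun i => G.cost i (G.fullPlay v₀ (Function.update σ j σ') h))

/-- A secure equilibrium in `(G, v₀)`. -/
def IsSecure (G : QRGame ι V) (v₀ : V) (σ : ι → List V → V) : Prop :=
  G.IsSecureAfter v₀ σ [v₀]

/-- A subgame perfect secure equilibrium: a secure equilibrium in every subgame. -/
def IsSPSE (G : QRGame ι V) (v₀ : V) (σ : ι → List V → V) : Prop :=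
  ∀ h : List V, G.IsHist v₀ h → G.IsSecureAfter v₀ σ h

end QRGame

namespace QRGame

section Reachability

variable {ι V : Type}

/-- The vertices from which the coalition against `j` can force the next vertex into `A`. -/
def controlPre (G : QRGame ι V) (j : ι) (A : Set V) : Set V :=
  {v | (G.owner v = j → ∀ w, G.E v w → w ∈ A) ∧ (G.owner v ≠ j → ∃ w ∈ A, G.E v w)}

lemma controlPre_mono (G : QRGame ι V) (j : ι) {A B : Set V} (h : A ⊆ B) :
    G.controlPre j A ⊆ G.controlPre j B := fun _ hv =>
  ⟨fun hj w hw => h (hv.1 hj w hw), fun hj => (hv.2 hj).imp fun _ hw => ⟨h hw.1, hw.2⟩⟩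

/-- The vertices from which the coalition against `j` can avoid `D` forever. -/
def safeRegion (G : QRGame ι V) (j : ι) (D : Set V) : Set V :=
  ⋃₀ {U | Disjoint U D ∧ U ⊆ G.controlPre j U}

lemma safeRegion_subset_controlPre (G : QRGame ι V) (j : ι) (D : Set V) :
    G.safeRegion j D ⊆ G.controlPre j (G.safeRegion j D) := by
  rintro v ⟨U, hU, hv⟩
  exact G.controlPre_mono j (Set.subset_sUnion_of_mem hU) (hU.2 hv)

lemma notMem_of_mem_safeRegion {G : QRGame ι V} {j : ι} {D : Set V} {v : V}
    (hv : v ∈ G.safeRegion j D) : v ∉ D := by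
  obtain ⟨U, hU, hvU⟩ := hv
  exact Set.disjoint_left.1 hU.1 hvU

/-- The vertices of `S` from which the coalition against `j` can force, inside `S`, a visit to
`T` within `n` steps. -/
def attractor (G : QRGame ι V) (j : ι) (S T : Set V) : ℕ → Set V
  | 0 => S ∩ T
  | n + 1 => attractor G j S T n ∪ (S ∩ G.controlPre j (attractor G j S T n))

lemma attractor_mono (G : QRGame ι V) (j : ι) (S T : Set V) : Monotone (G.attractor j S T) :=
  monotone_nat_of_le_succ fun _ => Set.subset_union_left

lemma attractor_subset (G : QRGame ι V) (j : ι) (S T : Set V) (n : ℕ) :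
    G.attractor j S T n ⊆ S := by
  induction n with
  | zero => exact Set.inter_subset_left
  | succ n ih => exact Set.union_subset ih Set.inter_subset_left

lemma attractor_card_succ [Fintype V] (G : QRGame ι V) (j : ι) (S T : Set V) :
    G.attractor j S T (Fintype.card V + 1) = G.attractor j S T (Fintype.card V) := by
  have hlt : ∀ n, G.attractor j S T (n + 1) ≠ G.attractor j S T n →
      (G.attractor j S T n).ncard < (G.attractor j S T (n + 1)).ncard := fun n h =>
    Set.ncard_lt_ncard ((G.attractor_mono j S T (Nat.le_succ n)).lt_of_ne h.symm) (Set.toFinite _)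
  have key : ∀ n, G.attractor j S T (n + 1) = G.attractor j S T n ∨
      n + 1 ≤ (G.attractor j S T (n + 1)).ncard := by
    intro n
    refine or_iff_not_imp_left.2 fun h => ?_
    have hcard := hlt n h
    induction n with
    | zero => omega
    | succ n ih =>
      have hne : G.attractor j S T (n + 1) ≠ G.attractor j S T n := fun heq => h <|
        congrArg (fun A => A ∪ (S ∩ G.controlPre j A)) heq
      have := ih hne (hlt n hne)
      omega
  refine (key _).resolve_right fun h => ?_
  have := Set.ncard_le_card (G.attractor j S T (Fintype.card V + 1))
  rw [Nat.card_eq_fintype_card] at this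
  omega

lemma mem_controlPre_of_mem_attractor_succ {G : QRGame ι V} {j : ι} {S T : Set V} {v : V} {n : ℕ}
    (hv : v ∈ G.attractor j S T (n + 1)) (h0 : v ∉ G.attractor j S T 0) :
    v ∈ G.controlPre j (G.attractor j S T n) := by
  induction n with
  | zero => exact (hv.resolve_left h0).2
  | succ n ih =>
    rcases hv with hv | hv
    · exact G.controlPre_mono j (G.attractor_mono j S T (Nat.le_succ n)) (ih hv)
    · exact hv.2

/-- If the coalition against `j` can, with memory (the states `X`), avoid `D` and reach `T`, then
a positional strategy avoids `D` and reaches `T` within `Fintype.card V` steps. -/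
lemma exists_positional [Fintype V] (G : QRGame ι V) (j : ι) (D T : Set V) :
    ∃ f : V → V, (∀ v, G.E v (f v)) ∧
      ∀ (X : Type) (lst : X → V) (Step : X → X → Prop) (H : X → Prop) (x₀ : X), H x₀ →
        (∀ x, H x → lst x ∉ D) →
        (∀ x, H x → G.owner (lst x) = j → ∀ w, G.E (lst x) w → ∃ y, Step x y ∧ H y ∧ lst y = w) →
        (∀ x, H x → G.owner (lst x) ≠ j → ∃ y, Step x y ∧ H y ∧ G.E (lst x) (lst y)) →
        (∀ s : ℕ → X, s 0 = x₀ → (∀ n, H (s n)) → (∀ n, Step (s n) (s (n + 1))) →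
          ∃ n, lst (s n) ∈ T) →
        ∀ p : ℕ → V, p 0 = lst x₀ → (∀ n, G.E (p n) (p (n + 1))) →
          (∀ n, G.owner (p n) ≠ j → p (n + 1) = f (p n)) →
          (∀ n, p n ∉ D) ∧ ∃ n ≤ Fintype.card V, p n ∈ T := by
  set S := G.safeRegion j D with hS
  set R := G.attractor j S T with hR
  have hf : ∀ v, ∃ w, G.E v w ∧ (v ∈ S → G.owner v ≠ j → w ∈ S) ∧
      ∀ n, v ∈ R (n + 1) → v ∉ R 0 → G.owner v ≠ j → w ∈ R n := by
    intro v
    by_cases hj : G.owner v = j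
    · obtain ⟨w, hw⟩ := G.total v
      exact ⟨w, hw, fun _ h => absurd hj h, fun _ _ _ h => absurd hj h⟩
    by_cases hv : ∃ n, v ∈ R n
    · rcases hn : Nat.find hv with - | m
      · have h0 : v ∈ R 0 := hn ▸ Nat.find_spec hv
        obtain ⟨w, hwS, hw⟩ := (G.safeRegion_subset_controlPre j D h0.1).2 hj
        exact ⟨w, hw, fun _ _ => hwS, fun _ _ h => absurd h0 h⟩
      · have hmem : v ∈ R (m + 1) := hn ▸ Nat.find_spec hv
        have hnot : v ∉ R m := Nat.find_min hv (by omega)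
        obtain ⟨w, hwR, hw⟩ := (hmem.resolve_left hnot).2.2 hj
        refine ⟨w, hw, fun _ _ => G.attractor_subset j S T m hwR, fun n hvn _ _ => ?_⟩
        have : Nat.find hv ≤ n + 1 := Nat.find_min' hv hvn
        exact G.attractor_mono j S T (by omega) hwR
    · push Not at hv
      by_cases hvS : v ∈ S
      · obtain ⟨w, hwS, hw⟩ := (G.safeRegion_subset_controlPre j D hvS).2 hj
        exact ⟨w, hw, fun _ _ => hwS, fun n hn => absurd hn (hv _)⟩
      · obtain ⟨w, hw⟩ := G.total v
        exact ⟨w, hw, fun h => absurd h hvS, fun n hn => absurd hn (hv _)⟩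
  choose f hfE hfS hfR using hf
  refine ⟨f, hfE, fun X lst Step H x₀ hx₀ hD hopp hown hT p hp0 hpE hpf => ?_⟩
  have hHS : ∀ x, H x → lst x ∈ S := fun x hx =>
    ⟨lst '' {x | H x}, ⟨Set.disjoint_left.2 (by rintro _ ⟨y, hy, rfl⟩; exact hD y hy), by
      rintro _ ⟨y, hy, rfl⟩
      refine ⟨fun hj w hw => ?_, fun hj => ?_⟩
      · obtain ⟨z, -, hz, rfl⟩ := hopp y hy hj w hw
        exact ⟨z, hz, rfl⟩
      · obtain ⟨z, -, hz, hE⟩ := hown y hy hj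
        exact ⟨lst z, ⟨z, hz, rfl⟩, hE⟩⟩, ⟨x, hx, rfl⟩⟩
  have hx₀R : lst x₀ ∈ R (Fintype.card V) := by
    by_contra hnot
    have hfix := G.attractor_card_succ j S T
    have hnext : ∀ x : {x // H x ∧ lst x ∉ R (Fintype.card V)},
        ∃ y : {x // H x ∧ lst x ∉ R (Fintype.card V)}, Step x y := by
      rintro ⟨x, hx, hxR⟩
      have hxR' : lst x ∉ G.controlPre j (R (Fintype.card V)) := fun h =>
        hxR (hfix.le (Or.inr ⟨hHS x hx, h⟩))
      by_cases hj : G.owner (lst x) = j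
      · have : ∃ w, G.E (lst x) w ∧ w ∉ R (Fintype.card V) := by
          by_contra hcon
          push Not at hcon
          exact hxR' ⟨fun _ => hcon, fun h => absurd hj h⟩
        obtain ⟨w, hw, hwR⟩ := this
        obtain ⟨y, hxy, hy, rfl⟩ := hopp x hx hj w hw
        exact ⟨⟨y, hy, hwR⟩, hxy⟩
      · obtain ⟨y, hxy, hy, hE⟩ := hown x hx hj
        exact ⟨⟨y, hy, fun h => hxR' ⟨fun h' => absurd h' hj, fun _ => ⟨_, h, hE⟩⟩⟩, hxy⟩
    choose next hstep using hnext
    let s : ℕ → {x // H x ∧ lst x ∉ R (Fintype.card V)} :=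
      fun n => next^[n] ⟨x₀, hx₀, hnot⟩
    obtain ⟨n, hn⟩ := hT (fun n => (s n).1) rfl (fun n => (s n).2.1) fun n => by
      simp only [s, Function.iterate_succ_apply']
      exact hstep _
    exact (s n).2.2 (G.attractor_mono j S T (Nat.zero_le _) ⟨hHS _ (s n).2.1, hn⟩)
  have hpS : ∀ n, p n ∈ S := by
    intro n
    induction n with
    | zero => exact hp0 ▸ hHS x₀ hx₀
    | succ n ih =>
      by_cases hj : G.owner (p n) = j
      · exact (G.safeRegion_subset_controlPre j D ih).1 hj _ (hpE n)
      · exact hpf n hj ▸ hfS _ ih hj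
  refine ⟨fun n => notMem_of_mem_safeRegion (hpS n), ?_⟩
  by_contra! hcon
  have hpR : ∀ n k, n + k = Fintype.card V → p n ∈ R k := by
    intro n
    induction n with
    | zero =>
      intro k hk
      obtain rfl : k = Fintype.card V := by omega
      exact hp0 ▸ hx₀R
    | succ n ih =>
      intro k hk
      have hmem := ih (k + 1) (by omega)
      have h0 : p n ∉ R 0 := fun h => hcon n (by omega) h.2
      by_cases hj : G.owner (p n) = j
      · exact (mem_controlPre_of_mem_attractor_succ hmem h0).1 hj _ (hpE n)
      · exact hpf n hj ▸ hfR _ k hmem h0 hj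
  exact hcon _ le_rfl (hpR _ 0 (by omega)).2

end Reachability

section Plays

variable {ι V : Type}

/-- The history (as a reversed list) consisting of the first `n + 1` vertices of a play. -/
def hist (p : ℕ → V) : ℕ → List V
  | 0 => [p 0]
  | n + 1 => p (n + 1) :: hist p n

@[simp]
lemma length_hist (p : ℕ → V) (n : ℕ) : (hist p n).length = n + 1 := by
  induction n with
  | zero => rfl
  | succ n ih => simp [hist, ih]

@[simp]
lemma cur_hist (v₀ : V) (p : ℕ → V) (n : ℕ) : cur v₀ (hist p n) = p n := by
  cases n <;> rfl

lemma hist_inj {p q : ℕ → V} {n : ℕ} : hist p n = hist q n ↔ ∀ t ≤ n, p t = q t := by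
  induction n with
  | zero => simp [hist]
  | succ n ih =>
    rw [hist, hist, List.cons.injEq, ih]
    refine ⟨fun h t ht => ?_, fun h => ⟨h _ le_rfl, fun t ht => h t (by omega)⟩⟩
    rcases Nat.le_succ_iff.1 ht with ht | rfl
    exacts [h.2 t ht, h.1]

lemma drop_hist_add (p : ℕ → V) (n k : ℕ) : (hist p (n + k)).drop k = hist p n := by
  induction k with
  | zero => rfl
  | succ k ih => exact ih

lemma isHist_hist {G : QRGame ι V} {v₀ : V} {p : ℕ → V} (h0 : p 0 = v₀) {n : ℕ}
    (hE : ∀ t < n, G.E (p t) (p (t + 1))) : G.IsHist v₀ (hist p n) := by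
  induction n with
  | zero => exact h0
  | succ n ih =>
    have := ih fun t ht => hE t (by omega)
    have hn := hE n (by omega)
    cases n <;> exact ⟨hn, this⟩

lemma exists_eq_hist_of_isHist {G : QRGame ι V} {v₀ : V} {h : List V} (hh : G.IsHist v₀ h) :
    ∃ (p : ℕ → V) (n : ℕ), h = hist p n ∧ p 0 = v₀ ∧ ∀ t < n, G.E (p t) (p (t + 1)) := by
  induction h with
  | nil => exact hh.elim
  | cons v l ih =>
    cases l with
    | nil => exact ⟨fun _ => v, 0, rfl, hh, by simp⟩
    | cons w l =>
      obtain ⟨p, n, hl, h0, hE⟩ := ih hh.2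
      have hw : w = p n := (congrArg (cur v₀) hl).trans (cur_hist v₀ p n)
      refine ⟨Function.update p (n + 1) v, n + 1, ?_, by simpa using h0, fun t ht => ?_⟩
      · rw [hist, Function.update_self, hl, hist_inj.2]
        intro t ht
        rw [Function.update_of_ne (by omega)]
      · rw [Function.update_of_ne (by omega : t ≠ n + 1)]
        rcases Nat.lt_succ_iff_lt_or_eq.1 ht with ht | rfl
        · rw [Function.update_of_ne (by omega)]
          exact hE t ht
        · rw [Function.update_self, ← hw]
          exact hh.1

lemma length_histFrom (G : QRGame ι V) (v₀ : V) (σ : ι → List V → V) (n : ℕ) :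
    (G.histFrom v₀ σ [v₀] n).length = n + 1 := by
  induction n with
  | zero => rfl
  | succ n ih => simp [histFrom, ih]

lemma outcome_eq_cur (G : QRGame ι V) (v₀ : V) (σ : ι → List V → V) (n : ℕ) :
    G.outcome v₀ σ n = cur v₀ (G.histFrom v₀ σ [v₀] n) := by
  have hlen := G.length_histFrom v₀ σ n
  rw [outcome, fullPlay]
  cases h : G.histFrom v₀ σ [v₀] n with
  | nil => simp [h] at hlen
  | cons w l =>
    rw [h, List.length_cons, Nat.add_right_cancel_iff] at hlen
    simp [cur, ← hlen]

lemma hist_outcome (G : QRGame ι V) (v₀ : V) (σ : ι → List V → V) (n : ℕ) :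
    hist (G.outcome v₀ σ) n = G.histFrom v₀ σ [v₀] n := by
  induction n with
  | zero => rfl
  | succ n ih => rw [hist, ih, outcome_eq_cur, histFrom]; rfl

lemma outcome_zero (G : QRGame ι V) (v₀ : V) (σ : ι → List V → V) : G.outcome v₀ σ 0 = v₀ := rfl

lemma outcome_succ (G : QRGame ι V) (v₀ : V) (σ : ι → List V → V) (n : ℕ) :
    G.outcome v₀ σ (n + 1) =
      σ (G.owner (G.outcome v₀ σ n)) (hist (G.outcome v₀ σ) n) := by
  rw [hist_outcome, outcome_eq_cur, outcome_eq_cur]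
  rfl

lemma outcome_edge {G : QRGame ι V} {v₀ : V} {σ : ι → List V → V} (hσ : G.IsProfile v₀ σ)
    (n : ℕ) : G.E (G.outcome v₀ σ n) (G.outcome v₀ σ (n + 1)) := by
  induction n using Nat.strong_induction_on with
  | _ n ih =>
    have := hσ (G.owner (G.outcome v₀ σ n)) (hist (G.outcome v₀ σ) n)
      (isHist_hist (G.outcome_zero v₀ σ) ih) (by rw [cur_hist])
    rwa [cur_hist, ← G.outcome_succ v₀ σ] at this

/-- The play `p` may arise from the profile `σ` when only player `j` deviates. -/
structure IsDeviation (G : QRGame ι V) (v₀ : V) (σ : ι → List V → V) (j : ι) (p : ℕ → V) :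
    Prop where
  start : p 0 = v₀
  edge : ∀ n, G.E (p n) (p (n + 1))
  follow : ∀ n, G.owner (p n) ≠ j → p (n + 1) = σ (G.owner (p n)) (hist p n)

lemma isDeviation_outcome {G : QRGame ι V} {v₀ : V} {σ : ι → List V → V}
    (hσ : G.IsProfile v₀ σ) (j : ι) : G.IsDeviation v₀ σ j (G.outcome v₀ σ) :=
  ⟨G.outcome_zero v₀ σ, outcome_edge hσ, fun n _ => G.outcome_succ v₀ σ n⟩

lemma exists_isStrat_following (G : QRGame ι V) (v₀ : V) (j : ι) (r : ℕ → V) :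
    ∃ σ' : List V → V, G.IsStrat v₀ j σ' ∧
      ∀ h, G.E (cur v₀ h) (r h.length) → σ' h = r h.length := by
  have : ∀ h : List V, ∃ w, G.E (cur v₀ h) w ∧ (G.E (cur v₀ h) (r h.length) → w = r h.length) := by
    intro h
    by_cases hr : G.E (cur v₀ h) (r h.length)
    · exact ⟨_, hr, fun _ => rfl⟩
    · obtain ⟨w, hw⟩ := G.total (cur v₀ h)
      exact ⟨w, hw, fun h' => absurd h' hr⟩
  choose σ' hE hr using this
  exact ⟨σ', fun h _ _ => hE h, hr⟩

lemma isProfile_update [DecidableEq ι] {G : QRGame ι V} {v₀ : V} {σ : ι → List V → V}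
    (hσ : G.IsProfile v₀ σ) {j : ι} {σ' : List V → V} (hσ' : G.IsStrat v₀ j σ') :
    G.IsProfile v₀ (Function.update σ j σ') := by
  intro i
  by_cases h : i = j
  · subst h
    simpa using hσ'
  · simpa [Function.update_of_ne h] using hσ i

lemma isDeviation_outcome_update [DecidableEq ι] {G : QRGame ι V} {v₀ : V} {σ : ι → List V → V}
    (hσ : G.IsProfile v₀ σ) {j : ι} {σ' : List V → V} (hσ' : G.IsStrat v₀ j σ') :
    G.IsDeviation v₀ σ j (G.outcome v₀ (Function.update σ j σ')) := by
  refine ⟨rfl, outcome_edge (isProfile_update hσ hσ'), fun n hn => ?_⟩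
  rw [outcome_succ, Function.update_of_ne hn]

lemma outcome_update_eq [DecidableEq ι] {G : QRGame ι V} {v₀ : V} {σ : ι → List V → V} {j : ι}
    {σ' : List V → V} {r : ℕ → V}
    (hr : ∀ h, G.E (cur v₀ h) (r h.length) → σ' h = r h.length) (h0 : r 0 = v₀) {N : ℕ}
    (hE : ∀ n < N, G.E (r n) (r (n + 1)))
    (hfollow : ∀ n < N, G.owner (r n) ≠ j → r (n + 1) = σ (G.owner (r n)) (hist r n)) :
    ∀ t ≤ N, G.outcome v₀ (Function.update σ j σ') t = r t := by
  intro t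
  induction t using Nat.strong_induction_on with
  | _ t ih =>
    intro ht
    cases t with
    | zero => exact h0.symm
    | succ t =>
      have hh : hist (G.outcome v₀ (Function.update σ j σ')) t = hist r t :=
        hist_inj.2 fun s hs => ih s (by omega) (by omega)
      rw [outcome_succ, hh, ih t (by omega) (by omega)]
      by_cases hj : G.owner (r t) = j
      · rw [hj, Function.update_self, hr, length_hist]
        rw [cur_hist, length_hist]
        exact hE t (by omega)
      · rw [Function.update_of_ne hj, ← hfollow t (by omega) hj]

lemma isSecure_iff [DecidableEq ι] {G : QRGame ι V} {v₀ : V} {σ : ι → List V → V}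
    (hσ : G.IsProfile v₀ σ) :
    G.IsSecure v₀ σ ↔ ∀ j p, G.IsDeviation v₀ σ j p →
      ¬ Prec j (fun i => G.cost i (G.outcome v₀ σ)) (fun i => G.cost i p) := by
  constructor
  · intro hs j p hp hprec
    obtain ⟨σ', hσ', hr⟩ := G.exists_isStrat_following v₀ j p
    refine hs ⟨j, σ', hσ', ?_⟩
    have : G.outcome v₀ (Function.update σ j σ') = p := funext fun t =>
      outcome_update_eq hr hp.start (N := t) (fun n _ => hp.edge n) (fun n _ => hp.follow n)
        t le_rfl
    rw [outcome] at this
    rw [this]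
    exact hprec
  · rintro h ⟨j, σ', hσ', hprec⟩
    exact h j _ (isDeviation_outcome_update hσ hσ') hprec

lemma IsDeviation.exists_hist_succ {G : QRGame ι V} {v₀ : V} {σ : ι → List V → V}
    (hσ : G.IsProfile v₀ σ) {j : ι} {p : ℕ → V} (hp : G.IsDeviation v₀ σ j p) {n : ℕ} {w : V}
    (hE : G.E (p n) w) (hw : G.owner (p n) ≠ j → w = σ (G.owner (p n)) (hist p n)) :
    ∃ q, G.IsDeviation v₀ σ j q ∧ hist q (n + 1) = w :: hist p n := by
  classical
  set r := Function.update p (n + 1) w with hr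
  have hrp : ∀ t ≤ n, r t = p t := fun t ht => Function.update_of_ne (by omega) _ _
  have hrn : r (n + 1) = w := Function.update_self _ _ _
  have hcases : ∀ t < n + 1, r t = p t ∧ hist r t = hist p t ∧ (t < n ∧ r (t + 1) = p (t + 1) ∨
      t = n ∧ r (t + 1) = w) := fun t ht => by
    refine ⟨hrp t (by omega), hist_inj.2 fun s hs => hrp s (by omega), ?_⟩
    rcases Nat.lt_succ_iff_lt_or_eq.1 ht with ht | rfl
    exacts [Or.inl ⟨ht, hrp _ ht⟩, Or.inr ⟨rfl, hrn⟩]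
  obtain ⟨σ', hσ', hfol⟩ := G.exists_isStrat_following v₀ j r
  refine ⟨_, isDeviation_outcome_update hσ hσ', ?_⟩
  have := outcome_update_eq (σ := σ) hfol ((hrp 0 (by omega)).trans hp.start) (N := n + 1)
    (fun t ht => by
      obtain ⟨h1, -, ⟨-, h3⟩ | ⟨rfl, h3⟩⟩ := hcases t ht <;> rw [h1, h3]
      exacts [hp.edge t, hE])
    (fun t ht => by
      obtain ⟨h1, h2, ⟨-, h3⟩ | ⟨rfl, h3⟩⟩ := hcases t ht <;> rw [h1, h2, h3]
      exacts [hp.follow t, hw])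
  rw [hist_inj.2 this, hist, hrn, hist_inj.2 hrp]

/-- A limit of growing histories of deviations is a deviation. -/
lemma exists_isDeviation_of_hist {G : QRGame ι V} {v₀ : V} {σ : ι → List V → V} {j : ι} {a : ℕ}
    {s : ℕ → List V} (hs : ∀ n, ∃ q, G.IsDeviation v₀ σ j q ∧ hist q (a + n) = s n)
    (hstep : ∀ n, ∃ w, s (n + 1) = w :: s n) :
    ∃ p, G.IsDeviation v₀ σ j p ∧ ∀ n, hist p (a + n) = s n := by
  obtain ⟨q₀, hq₀, hq₀s⟩ := hs 0
  set p : ℕ → V := fun t => if t ≤ a then q₀ t else cur v₀ (s (t - a)) with hp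
  have hps : ∀ n, hist p (a + n) = s n := by
    intro n
    induction n with
    | zero =>
      rw [← hq₀s]
      exact hist_inj.2 fun t ht => if_pos ht
    | succ n ih =>
      obtain ⟨w, hw⟩ := hstep n
      have : p (a + n + 1) = w := by
        rw [hp]
        simp only [show ¬ a + n + 1 ≤ a by omega, if_false]
        rw [show a + n + 1 - a = n + 1 by omega, hw]
        rfl
      rw [← Nat.add_assoc, hist, ih, hw, this]
  have key : ∀ n, ∃ q, G.IsDeviation v₀ σ j q ∧ ∀ t ≤ a + n, p t = q t := fun n => by
    obtain ⟨q, hq, hqs⟩ := hs n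
    exact ⟨q, hq, hist_inj.1 ((hps n).trans hqs.symm)⟩
  refine ⟨p, ⟨?_, fun n => ?_, fun n => ?_⟩, hps⟩
  · obtain ⟨q, hq, h⟩ := key 0
    rw [h 0 (by omega), hq.start]
  · obtain ⟨q, hq, h⟩ := key (n + 1)
    rw [h n (by omega), h (n + 1) (by omega)]
    exact hq.edge n
  · obtain ⟨q, hq, h⟩ := key (n + 1)
    rw [h n (by omega), h (n + 1) (by omega),
      hist_inj.2 fun t (ht : t ≤ n) => h t (by omega)]
    exact hq.follow n

end Plays

section Cost

variable {ι V : Type} {G : QRGame ι V} {i : ι} {p q : ℕ → V}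

lemma cost_le {t : ℕ} (h : p t ∈ G.F i) : G.cost i p ≤ t := iInf₂_le t h

lemma le_cost_iff {x : ℕ∞} : x ≤ G.cost i p ↔ ∀ t : ℕ, p t ∈ G.F i → x ≤ t := le_iInf₂_iff

lemma cost_lt_iff {x : ℕ∞} : G.cost i p < x ↔ ∃ t : ℕ, p t ∈ G.F i ∧ (t : ℕ∞) < x := by
  simp [← not_le, le_cost_iff]

lemma cost_le_cost_of_agree {a : ℕ} (h : ∀ t ≤ a, p t = q t) (hp : ∃ t ≤ a, p t ∈ G.F i) :
    G.cost i q ≤ G.cost i p := by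
  refine le_cost_iff.2 fun t ht => ?_
  obtain ⟨s, hs, hsF⟩ := hp
  rcases le_total t a with hta | hta
  · exact cost_le (h t hta ▸ ht)
  · exact (cost_le (h s hs ▸ hsF)).trans (by exact_mod_cast hs.trans hta)

lemma cost_eq_of_agree {a : ℕ} (h : ∀ t ≤ a, p t = q t) (hp : ∃ t ≤ a, p t ∈ G.F i) :
    G.cost i p = G.cost i q :=
  le_antisymm
    (cost_le_cost_of_agree (fun t ht => (h t ht).symm) (hp.imp fun t ⟨ht, hF⟩ => ⟨ht, h t ht ▸ hF⟩))
    (cost_le_cost_of_agree h hp)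

lemma cost_eq_cost_add {a b : ℕ} (h : ∀ t, a < t → q (t + b) = p t)
    (hp : ∀ t ≤ a, p t ∉ G.F i) (hq : ∀ t ≤ a + b, q t ∉ G.F i) :
    G.cost i q = G.cost i p + b := by
  apply le_antisymm
  · by_cases htop : G.cost i p = ⊤
    · simp [htop]
    · obtain ⟨n, hn⟩ := ENat.ne_top_iff_exists.1 htop
      obtain ⟨t, ht, htn⟩ := cost_lt_iff.1 (show G.cost i p < ((n + 1 : ℕ) : ℕ∞) by
        rw [← hn]; exact_mod_cast Nat.lt_succ_self n)
      have hta : a < t := not_le.1 fun hle => hp t hle ht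
      have htn : t ≤ n := Nat.lt_succ_iff.1 (by exact_mod_cast htn)
      rw [← hn]
      exact (cost_le ((h t hta).symm ▸ ht)).trans (by exact_mod_cast Nat.add_le_add_right htn b)
  · refine le_cost_iff.2 fun t ht => ?_
    have hta : a + b < t := not_le.1 fun hle => hq t hle ht
    obtain ⟨s, rfl⟩ : ∃ s, t = s + b := ⟨t - b, by omega⟩
    rw [h s (by omega)] at ht
    push_cast
    gcongr
    exact cost_le ht

end Cost

section Splice

variable {ι V : Type}

/-- Every play that extends the history `h` (of length `a`), and in which only `j` deviates from
`σ`, avoids `D` and visits `T` from time `a` on. -/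
def Forces (G : QRGame ι V) (v₀ : V) (σ : ι → List V → V) (a : ℕ) (j : ι) (D T : Set V)
    (h : List V) : Prop :=
  ∀ q, G.IsDeviation v₀ σ j q → hist q a = h → (∀ n ≥ a, q n ∉ D) ∧ ∃ n ≥ a, q n ∈ T

lemma exists_positional_of_forces [Fintype V] {G : QRGame ι V} {v₀ : V} {σ : ι → List V → V}
    (hσ : G.IsProfile v₀ σ) (a : ℕ) (j : ι) (D T : Set V) :
    ∃ f : V → V, (∀ v, G.E v (f v)) ∧
      ∀ q, G.IsDeviation v₀ σ j q → G.Forces v₀ σ a j D T (hist q a) →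
        ∀ p : ℕ → V, p a = q a → (∀ n, G.E (p n) (p (n + 1))) →
          (∀ n ≥ a, G.owner (p n) ≠ j → p (n + 1) = f (p n)) →
          (∀ n ≥ a, p n ∉ D) ∧ ∃ n, n ≤ a + Fintype.card V ∧ p n ∈ T := by
  obtain ⟨f, hfE, hf⟩ := G.exists_positional j D T
  refine ⟨f, hfE, fun q hq hforces p hpa hpE hpf => ?_⟩
  have := hf (List V) (cur v₀) (fun x y => ∃ w, y = w :: x)
    (fun x => ∃ r n, G.IsDeviation v₀ σ j r ∧ hist r a = hist q a ∧ hist r (a + n) = x)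
    (hist q a) ⟨q, 0, hq, rfl, rfl⟩ ?_ ?_ ?_ ?_ (fun n => p (a + n)) (by simp [hpa])
    (fun n => hpE _) (fun n hn => hpf _ (Nat.le_add_right a n) hn)
  · obtain ⟨hD, n, hn, hT⟩ := this
    refine ⟨fun n hn => ?_, a + n, by omega, hT⟩
    obtain ⟨k, rfl⟩ := Nat.exists_eq_add_of_le hn
    exact hD k
  · rintro _ ⟨r, n, hr, hra, rfl⟩
    rw [cur_hist]
    exact (hforces r hr hra).1 _ (Nat.le_add_right a n)
  · rintro _ ⟨r, n, hr, hra, rfl⟩ hj w hw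
    rw [cur_hist] at hj hw
    obtain ⟨r', hr', hr'n⟩ := hr.exists_hist_succ hσ hw fun h => absurd hj h
    refine ⟨_, ⟨w, rfl⟩, ⟨r', n + 1, hr', ?_, hr'n⟩, rfl⟩
    rw [← hra, ← drop_hist_add r a n, ← drop_hist_add r' a (n + 1), ← Nat.add_assoc, hr'n]
    rfl
  · rintro _ ⟨r, n, hr, hra, rfl⟩ -
    rw [cur_hist]
    exact ⟨hist r (a + n + 1), ⟨_, rfl⟩, ⟨r, n + 1, hr, hra, rfl⟩, by rw [cur_hist]; exact hr.edge _⟩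
  · intro s hs0 hsH hstep
    have hlen : ∀ n, (s n).length = a + n + 1 := by
      intro n
      induction n with
      | zero => simp [hs0]
      | succ n ih =>
        obtain ⟨w, hw⟩ := hstep n
        simp [hw, ih]
        omega
    obtain ⟨r, hr, hrs⟩ := exists_isDeviation_of_hist (G := G) (v₀ := v₀) (σ := σ) (j := j)
      (a := a) (s := s) (fun n => by
        obtain ⟨r, m, hr, -, hm⟩ := hsH n
        have := hlen n
        rw [← hm, length_hist] at this
        obtain rfl : m = n := by omega
        exact ⟨r, hr, hm⟩) hstep
    obtain ⟨n, hn, hT⟩ := (hforces r hr ((hrs 0).trans hs0)).2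
    obtain ⟨k, rfl⟩ := Nat.exists_eq_add_of_le hn
    exact ⟨k, by rwa [← hrs, cur_hist]⟩

/-- The play `p` with its first `a` steps replaced by the first `a + b` steps of `ρ`. -/
def insertCycle (ρ : ℕ → V) (a b : ℕ) (p : ℕ → V) (t : ℕ) : V :=
  if t ≤ a + b then ρ t else p (t - b)

lemma insertCycle_of_le {ρ p : ℕ → V} {a b t : ℕ} (h : t ≤ a + b) :
    insertCycle ρ a b p t = ρ t := if_pos h

lemma insertCycle_add {ρ p : ℕ → V} {a b t : ℕ} (hcycle : ρ a = ρ (a + b)) (hpa : p a = ρ a)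
    (h : a ≤ t) : insertCycle ρ a b p (t + b) = p t := by
  rcases h.eq_or_lt with rfl | h
  · rw [insertCycle_of_le le_rfl, hpa, hcycle]
  · rw [insertCycle, if_neg (by omega), Nat.add_sub_cancel]

lemma hist_insertCycle (ρ p : ℕ → V) (a b k : ℕ) :
    hist (insertCycle ρ a b p) (a + b + k) = (hist p (a + k)).take k ++ hist ρ (a + b) := by
  induction k with
  | zero => exact hist_inj.2 fun t ht => insertCycle_of_le ht
  | succ k ih =>
    rw [← Nat.add_assoc, ← Nat.add_assoc, hist, hist, ih, insertCycle, if_neg (by omega),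
      show a + b + k + 1 - b = a + k + 1 by omega]
    rfl

lemma insertCycle_edge {G : QRGame ι V} {ρ p : ℕ → V} {a b N : ℕ}
    (hρ : ∀ t, G.E (ρ t) (ρ (t + 1))) (hcycle : ρ a = ρ (a + b)) (hpa : p a = ρ a)
    (hp : ∀ t < a + N, G.E (p t) (p (t + 1))) {t : ℕ} (ht : t < a + b + N) :
    G.E (insertCycle ρ a b p t) (insertCycle ρ a b p (t + 1)) := by
  by_cases h : t < a + b
  · rw [insertCycle_of_le h.le, insertCycle_of_le h]
    exact hρ t
  · obtain ⟨s, rfl⟩ : ∃ s, t = s + b := ⟨t - b, by omega⟩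
    rw [insertCycle_add hcycle hpa (by omega), Nat.add_right_comm,
      insertCycle_add hcycle hpa (by omega)]
    exact hp s (by omega)

/-- The profile that follows `σ` up to time `a`; from then on it plays as `σ` does after the
inserted cycle if the history so far agrees with the outcome of `σ`, plays the positional
strategy `f j` if `P j` holds of the history at time `a`, and follows `σ` otherwise. -/
lemma exists_spliced_profile {G : QRGame ι V} {v₀ : V} {σ : ι → List V → V}
    (hσ : G.IsProfile v₀ σ) {a b : ℕ} (hcycle : G.outcome v₀ σ a = G.outcome v₀ σ (a + b))
    (P : ι → List V → Prop) {f : ι → V → V} (hf : ∀ j v, G.E v (f j v)) :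
    ∃ τ : ι → List V → V, G.IsProfile v₀ τ ∧
      (∀ i p n, n < a → τ i (hist p n) = σ i (hist p n)) ∧
      (∀ i p k, hist p a = hist (G.outcome v₀ σ) a → τ i (hist p (a + k)) =
        σ i (hist (insertCycle (G.outcome v₀ σ) a b p) (a + b + k))) ∧
      (∀ i p k j, hist p a ≠ hist (G.outcome v₀ σ) a → P j (hist p a) →
        (∀ j', P j' (hist p a) → j' = j) → τ i (hist p (a + k)) = f j (p (a + k))) ∧
      (∀ i p k, hist p a ≠ hist (G.outcome v₀ σ) a → (∀ j, ¬ P j (hist p a)) →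
        τ i (hist p (a + k)) = σ i (hist p (a + k))) := by
  classical
  set ρ := G.outcome v₀ σ with hρ
  let τ : ι → List V → V := fun i h =>
    if h.length ≤ a then σ i h
    else if h.drop (h.length - (a + 1)) = hist ρ a then
      σ i (h.take (h.length - (a + 1)) ++ hist ρ (a + b))
    else if hP : ∃ j, P j (h.drop (h.length - (a + 1))) then f hP.choose (cur v₀ h)
    else σ i h
  have hsub : ∀ k, a + k + 1 - (a + 1) = k := fun k => by omega
  have hlen : ∀ k, ¬ a + k + 1 ≤ a := fun k => by omega
  have h1 : ∀ i p n, n < a → τ i (hist p n) = σ i (hist p n) := fun i p n hn => by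
    simp only [τ, length_hist, if_pos (Nat.succ_le_of_lt hn)]
  have h2 : ∀ i p k, hist p a = hist ρ a → τ i (hist p (a + k)) =
      σ i (hist (insertCycle ρ a b p) (a + b + k)) := fun i p k h => by
    simp only [τ, length_hist, hsub, drop_hist_add, if_neg (hlen k), if_pos h, hist_insertCycle]
  have h3 : ∀ i p k, hist p a ≠ hist ρ a → ∀ hP : ∃ j, P j (hist p a),
      τ i (hist p (a + k)) = f hP.choose (p (a + k)) := fun i p k h hP => by
    simp only [τ, length_hist, hsub, drop_hist_add, if_neg (hlen k), if_neg h, dif_pos hP,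
      cur_hist]
  have h4 : ∀ i p k, hist p a ≠ hist ρ a → (¬ ∃ j, P j (hist p a)) →
      τ i (hist p (a + k)) = σ i (hist p (a + k)) := fun i p k h hP => by
    simp only [τ, length_hist, hsub, drop_hist_add, if_neg (hlen k), if_neg h, dif_neg hP]
  refine ⟨τ, ?_, h1, h2, fun i p k j h hj huniq => ?_, fun i p k h hP => h4 i p k h (by simpa)⟩
  · intro i h hh hi
    have hσh := hσ i h hh hi
    obtain ⟨p, n, rfl, hp0, hpE⟩ := exists_eq_hist_of_isHist hh
    rcases lt_or_ge n a with hn | hn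
    · rwa [h1 i p n hn]
    obtain ⟨k, rfl⟩ := Nat.exists_eq_add_of_le hn
    by_cases hpa : hist p a = hist ρ a
    · rw [h2 i p k hpa]
      have hpaa := hist_inj.1 hpa a le_rfl
      have hcur : insertCycle ρ a b p (a + b + k) = p (a + k) := by
        rw [Nat.add_right_comm, insertCycle_add hcycle hpaa (by omega)]
      have := hσ i (hist (insertCycle ρ a b p) (a + b + k))
        (isHist_hist ((insertCycle_of_le (by omega)).trans (G.outcome_zero v₀ σ)) fun t ht =>
          insertCycle_edge (outcome_edge hσ) hcycle hpaa hpE ht)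
      rw [cur_hist, hcur] at this
      rw [cur_hist] at hi ⊢
      exact this hi
    · by_cases hP : ∃ j, P j (hist p a)
      · rw [h3 i p k hpa hP, cur_hist]
        exact hf _ _
      · rwa [h4 i p k hpa hP]
  · have hP : ∃ j, P j (hist p a) := ⟨j, hj⟩
    rw [h3 i p k h hP, huniq _ hP.choose_spec]

lemma IsDeviation.eq_outcome_of_ne {G : QRGame ι V} {v₀ : V} {σ : ι → List V → V} {i j : ι}
    {p q : ℕ → V} (hp : G.IsDeviation v₀ σ i p) (hq : G.IsDeviation v₀ σ j q) (hij : i ≠ j)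
    {n : ℕ} (hpq : hist p n = hist q n) : hist p n = hist (G.outcome v₀ σ) n := by
  induction n with
  | zero => simp [hist, hp.start, outcome_zero]
  | succ n ih =>
    have hpq' := hist_inj.1 hpq
    have hh : hist p n = hist q n := (List.cons.inj hpq).2
    have ho := ih hh
    have hn := hist_inj.1 ho n le_rfl
    rw [hist, hist, ho, outcome_succ, ← ho, ← hn]
    congr 1
    by_cases h : G.owner (p n) = i
    · rw [hpq' (n + 1) le_rfl, hq.follow n, ← hh, ← hpq' n (by omega)]
      rw [← hpq' n (by omega), h]
      exact hij
    · exact hp.follow n h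

/-- Security against deviations of `j` that leave the outcome after the removed cycle. -/
lemma not_prec_of_not_prec_insertCycle {G : QRGame ι V} {ρ ρ' p : ℕ → V} {a b : ℕ} {j : ι}
    (hρ' : ∀ t ≤ a, ρ' t = ρ t) (hρ'b : ∀ t, a < t → ρ' t = ρ (t + b))
    (hvisit : ∀ i, (∃ t ≤ a + b, ρ t ∈ G.F i) → ∃ t ≤ a, ρ t ∈ G.F i)
    (hpa : ∀ t ≤ a, p t = ρ t)
    (h : ¬ Prec j (fun i => G.cost i ρ) (fun i => G.cost i (insertCycle ρ a b p))) :
    ¬ Prec j (fun i => G.cost i ρ') (fun i => G.cost i p) := by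
  have key : ∀ i, (G.cost i ρ = G.cost i ρ' ∧ G.cost i (insertCycle ρ a b p) = G.cost i p) ∨
      (G.cost i ρ = G.cost i ρ' + b ∧ G.cost i (insertCycle ρ a b p) = G.cost i p + b) := by
    intro i
    by_cases hi : ∃ t ≤ a, ρ t ∈ G.F i
    · left
      refine ⟨cost_eq_of_agree (fun t ht => (hρ' t ht).symm) hi, ?_⟩
      refine (cost_eq_of_agree (a := a) (fun t ht => ?_) ?_).symm
      · rw [hpa t ht, insertCycle_of_le (by omega)]
      · exact hi.imp fun t ⟨ht, hF⟩ => ⟨ht, (hpa t ht).symm ▸ hF⟩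
    · right
      have hiab : ∀ t ≤ a + b, ρ t ∉ G.F i := fun t ht hF => hi (hvisit i ⟨t, ht, hF⟩)
      push Not at hi
      refine ⟨cost_eq_cost_add (fun t ht => (hρ'b t ht).symm)
        (fun t ht => (hρ' t ht).symm ▸ hi t ht) hiab, cost_eq_cost_add (a := a) (fun t ht => ?_)
        (fun t ht => (hpa t ht).symm ▸ hi t ht)
        (fun t ht => by rw [insertCycle_of_le ht]; exact hiab t ht)⟩
      rw [insertCycle, if_neg (by omega), Nat.add_sub_cancel]
  have hb : (b : ℕ∞) ≠ ⊤ := ENat.natCast_ne_top b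
  have hlt : ∀ x y : ℕ∞, x + b < y + b ↔ x < y := fun x y => ENat.add_lt_add_iff_right hb
  have hle : ∀ x y : ℕ∞, x + b ≤ y + b ↔ x ≤ y := fun x y => ENat.add_le_add_iff_right hb
  have hLT : ∀ i, G.cost i ρ < G.cost i (insertCycle ρ a b p) ↔ G.cost i ρ' < G.cost i p :=
    fun i => by rcases key i with ⟨h1, h2⟩ | ⟨h1, h2⟩ <;> rw [h1, h2]; exact hlt _ _
  have hGT : ∀ i, G.cost i (insertCycle ρ a b p) < G.cost i ρ ↔ G.cost i p < G.cost i ρ' :=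
    fun i => by rcases key i with ⟨h1, h2⟩ | ⟨h1, h2⟩ <;> rw [h1, h2]; exact hlt _ _
  have hLE : ∀ i, G.cost i ρ ≤ G.cost i (insertCycle ρ a b p) ↔ G.cost i ρ' ≤ G.cost i p :=
    fun i => by rcases key i with ⟨h1, h2⟩ | ⟨h1, h2⟩ <;> rw [h1, h2]; exact hle _ _
  have hEQ : ∀ i, G.cost i ρ = G.cost i (insertCycle ρ a b p) ↔ G.cost i ρ' = G.cost i p :=
    fun i => by
      simp only [le_antisymm_iff, hLE, ← not_lt (a := G.cost i ρ), hLT, not_lt]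
  simpa only [Prec, hLT, hGT, hLE, hEQ] using h

end Splice

end QRGame

/-- Lemma 5.4 (removing an unnecessary cycle): let `(σ_i)` be a secure
equilibrium with outcome `ρ`, and suppose `ρ = αβγρ̄` where `α` is the prefix
ending at position `a`, `β` is the nonempty cycle of length `b ≥ 1` (so
`ρ a = ρ (a + b)`), and `γ` has length `c ≥ |V|`; assume moreover that the set
of players whose goal set is visited by `αβγ` equals the one for `α`, and that
`ρ` visits some goal set not visited by `α`.  Then there exists a secure
equilibrium whose outcome is `αγρ̄`, i.e. the play `t ↦ if t ≤ a then ρ t else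
ρ (t + b)` obtained by removing the cycle `β`. -/
theorem remove_unnecessary_cycle
    {ι V : Type} [Fintype ι] [Fintype V] [DecidableEq ι]
    (G : QRGame ι V) (v₀ : V)
    (σ : ι → List V → V) (hprof : G.IsProfile v₀ σ) (hsec : G.IsSecure v₀ σ)
    (a b c : ℕ) (hb : 1 ≤ b) (hc : Fintype.card V ≤ c)
    (hcycle : G.outcome v₀ σ a = G.outcome v₀ σ (a + b))
    (hvisit :
      {i : ι | ∃ t ≤ a, G.outcome v₀ σ t ∈ G.F i} =
        {i : ι | ∃ t ≤ a + b + c, G.outcome v₀ σ t ∈ G.F i})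
    (hvisit' :
      {i : ι | ∃ t, G.outcome v₀ σ t ∈ G.F i} ≠
        {i : ι | ∃ t ≤ a, G.outcome v₀ σ t ∈ G.F i}) :
    ∃ τ : ι → List V → V, G.IsProfile v₀ τ ∧ G.IsSecure v₀ τ ∧
      ∀ t, G.outcome v₀ τ t =
        if t ≤ a then G.outcome v₀ σ t else G.outcome v₀ σ (t + b) := by
  classical
  set ρ := G.outcome v₀ σ with hρ
  set ρ' : ℕ → V := fun t => if t ≤ a then ρ t else ρ (t + b) with hρ'
  have hρ'le : ∀ t ≤ a, ρ' t = ρ t := fun t ht => if_pos ht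
  have hρ'gt : ∀ t, a < t → ρ' t = ρ (t + b) := fun t ht => if_neg (not_le.2 ht)
  have hρ'ge : ∀ t, a ≤ t → ρ' t = ρ (t + b) := fun t ht => by
    rcases ht.eq_or_lt with rfl | ht
    exacts [(hρ'le _ le_rfl).trans hcycle, hρ'gt t ht]
  have hins : QRGame.insertCycle ρ a b ρ' = ρ := by
    funext t
    rcases le_or_gt t (a + b) with ht | ht
    · exact QRGame.insertCycle_of_le ht
    · rw [QRGame.insertCycle, if_neg (by omega), hρ'gt _ (by omega), Nat.sub_add_cancel (by omega)]
  have hvis : ∀ i, (∃ t ≤ a + b + c, ρ t ∈ G.F i) → ∃ t ≤ a, ρ t ∈ G.F i :=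
    fun i hi => hvisit.ge hi
  let D : ι → Set V := fun j => {v | v ∈ G.F j ∧ ¬ ∃ t ≤ a, ρ t ∈ G.F j}
  let T : Set V := {v | ∃ i, (¬ ∃ t ≤ a, ρ t ∈ G.F i) ∧ v ∈ G.F i}
  choose f hfE hf using fun j => QRGame.exists_positional_of_forces hprof a j (D j) T
  let P : ι → List V → Prop := fun j h =>
    (∃ q, G.IsDeviation v₀ σ j q ∧ QRGame.hist q a = h) ∧ G.Forces v₀ σ a j (D j) T h
  obtain ⟨τ, hτ, hτlt, hτcycle, hτP, hτσ⟩ := QRGame.exists_spliced_profile hprof hcycle P hfE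
  have hout : ∀ t, G.outcome v₀ τ t = ρ' t := by
    intro t
    induction t using Nat.strong_induction_on with
    | _ t ih =>
      cases t with
      | zero => exact (hρ'le 0 (Nat.zero_le a)).symm
      | succ t =>
        rw [QRGame.outcome_succ, QRGame.hist_inj.2 fun s (hs : s ≤ t) => ih s (by omega),
          ih t (by omega)]
        rcases lt_or_ge t a with ht | ht
        · rw [hτlt _ _ _ ht, QRGame.hist_inj.2 fun s (hs : s ≤ t) => hρ'le s (by omega),
            hρ'le t ht.le, hρ'le _ ht]
          exact (G.outcome_succ v₀ σ t).symm
        · obtain ⟨k, rfl⟩ := Nat.exists_eq_add_of_le ht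
          rw [hτcycle _ _ _ (QRGame.hist_inj.2 hρ'le), hins, hρ'ge _ ht, hρ'gt _ (by omega),
            show a + k + 1 + b = a + b + k + 1 by omega, show a + k + b = a + b + k by omega]
          exact (G.outcome_succ v₀ σ _).symm
  refine ⟨τ, hτ, ?_, hout⟩
  rw [QRGame.isSecure_iff hτ, show G.outcome v₀ τ = ρ' from funext hout]
  rw [QRGame.isSecure_iff hprof] at hsec
  have hcost_eq : ∀ i, (∃ t ≤ a, ρ t ∈ G.F i) → G.cost i ρ' = G.cost i ρ := fun i hi =>
    (QRGame.cost_eq_of_agree (fun t ht => (hρ'le t ht).symm) hi).symm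
  have hcost_add : ∀ i, (¬ ∃ t ≤ a, ρ t ∈ G.F i) → G.cost i ρ = G.cost i ρ' + b := fun i hi => by
    have hnot : ∀ t ≤ a + b + c, ρ t ∉ G.F i := fun t ht hF => hi (hvis i ⟨t, ht, hF⟩)
    exact QRGame.cost_eq_cost_add (fun t ht => (hρ'gt t ht).symm)
      (fun t ht => (hρ'le t ht).symm ▸ hnot t (by omega)) fun t ht => hnot t (by omega)
  have hcost_le : ∀ i, G.cost i ρ' ≤ G.cost i ρ := fun i => by
    by_cases hi : ∃ t ≤ a, ρ t ∈ G.F i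
    exacts [(hcost_eq i hi).le, hcost_add i hi ▸ le_self_add]
  have hcost_late : ∀ i, (¬ ∃ t ≤ a, ρ t ∈ G.F i) → ((a + c : ℕ) : ℕ∞) < G.cost i ρ' :=
    fun i hi => by
      have hnot : ∀ t ≤ a + b + c, ρ t ∉ G.F i := fun t ht hF => hi (hvis i ⟨t, ht, hF⟩)
      refine lt_of_lt_of_le (b := ((a + c + 1 : ℕ) : ℕ∞)) (by exact_mod_cast Nat.lt_succ_self _)
        (QRGame.le_cost_iff.2 fun t ht => ?_)
      by_contra hlt
      have hlt : t < a + c + 1 := by exact_mod_cast not_le.1 hlt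
      rcases le_total t a with hta | hta
      · exact hnot t (by omega) (hρ'le t hta ▸ ht)
      · exact hnot (t + b) (by omega) (hρ'ge t hta ▸ ht)
  have hcost_early : ∀ i, (∃ t ≤ a, ρ t ∈ G.F i) → G.cost i ρ' ≤ a := fun i ⟨t, ht, hF⟩ =>
    (QRGame.cost_le ((hρ'le t ht).symm ▸ hF)).trans (by exact_mod_cast ht)
  intro j p hp
  by_cases hpa : QRGame.hist p a = QRGame.hist ρ a
  · -- the deviation takes place after the removed cycle
    have hpρ := QRGame.hist_inj.1 hpa
    refine QRGame.not_prec_of_not_prec_insertCycle hρ'le hρ'gt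
      (fun i ⟨t, ht, hF⟩ => hvis i ⟨t, by omega, hF⟩) hpρ (hsec j _ ⟨?_, fun n => ?_, fun n hn => ?_⟩)
    · rw [QRGame.insertCycle_of_le (by omega)]
      rfl
    · exact QRGame.insertCycle_edge (QRGame.outcome_edge hprof) hcycle (hpρ a le_rfl)
        (N := n + 1) (fun t _ => hp.edge t) (by omega)
    · rcases lt_or_ge n (a + b) with h | h
      · rw [QRGame.insertCycle_of_le h, QRGame.insertCycle_of_le h.le,
          QRGame.hist_inj.2 fun t (ht : t ≤ n) => QRGame.insertCycle_of_le (by omega)]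
        exact G.outcome_succ v₀ σ n
      · obtain ⟨k, rfl⟩ := Nat.exists_eq_add_of_le h
        have hk : QRGame.insertCycle ρ a b p (a + b + k) = p (a + k) := by
          rw [Nat.add_right_comm, QRGame.insertCycle_add hcycle (hpρ a le_rfl) (by omega)]
        rw [hk] at hn ⊢
        rw [← hτcycle _ p k hpa, ← hp.follow _ hn, show a + b + k + 1 = a + k + 1 + b by omega,
          QRGame.insertCycle_add hcycle (hpρ a le_rfl) (by omega)]
  · obtain ⟨q, hq, hqp⟩ : ∃ q, G.IsDeviation v₀ σ j q ∧ ∀ t ≤ a, q t = p t := by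
      obtain ⟨σ', hσ', hfol⟩ := G.exists_isStrat_following v₀ j p
      exact ⟨_, QRGame.isDeviation_outcome_update hprof hσ', QRGame.outcome_update_eq hfol hp.start
        (fun n _ => hp.edge n) fun n hn hj => (hp.follow n hj).trans (hτlt _ _ _ hn)⟩
    have hqa : QRGame.hist q a = QRGame.hist p a := QRGame.hist_inj.2 hqp
    have huniq : ∀ i, P i (QRGame.hist p a) → i = j := by
      rintro i ⟨⟨q', hq', hq'a⟩, -⟩
      by_contra hij
      exact hpa (hq'a ▸ hq'.eq_outcome_of_ne hq hij (hq'a.trans hqa.symm))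
    by_cases hPj : P j (QRGame.hist p a)
    · -- the coalition punishes `j` with its positional strategy
      obtain ⟨hpD, n, hn, i, hi, hiF⟩ := hf j q hq (hqa ▸ hPj.2) p (hqp a le_rfl).symm hp.edge
        fun n hn hj => by
          obtain ⟨k, rfl⟩ := Nat.exists_eq_add_of_le hn
          rw [hp.follow _ hj, hτP _ p k j hpa hPj huniq]
      rintro (hlt | ⟨-, hle, -⟩)
      · obtain ⟨t, htF, ht⟩ := QRGame.cost_lt_iff.1 hlt
        rcases le_or_gt t a with hta | hta
        · exact hsec j q hq (Or.inl ((QRGame.cost_le ((hqp t hta).symm ▸ htF)).trans_lt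
            (ht.trans_le (hcost_le j))))
        · by_cases hj : ∃ t ≤ a, ρ t ∈ G.F j
          · have : t < a := by exact_mod_cast ht.trans_le (hcost_early j hj)
            omega
          · exact hpD t hta.le ⟨htF, hj⟩
      · refine ((hle i).trans (QRGame.cost_le hiF)).not_gt (lt_of_le_of_lt ?_ (hcost_late i hi))
        exact_mod_cast hn.trans (Nat.add_le_add_left hc a)
    · -- the coalition follows `σ`
      have hpσ : G.IsDeviation v₀ σ j p := ⟨hp.start, hp.edge, fun n hj => by
        rw [hp.follow n hj]
        rcases lt_or_ge n a with h | h
        · exact hτlt _ _ _ h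
        · obtain ⟨k, rfl⟩ := Nat.exists_eq_add_of_le h
          exact hτσ _ p k hpa fun i hi => hPj (huniq i hi ▸ hi)⟩
      rintro (hlt | ⟨heq, hle, -⟩)
      · exact hsec j p hpσ (Or.inl (lt_of_lt_of_le hlt (hcost_le j)))
      have hρj : G.cost j ρ' = G.cost j ρ := (hcost_le j).antisymm <|
        (not_lt.1 fun h => hsec j p hpσ (Or.inl h)).trans heq.ge
      have hjtop : (¬ ∃ t ≤ a, ρ t ∈ G.F j) → G.cost j ρ = ⊤ := fun hj => by
        by_contra hne
        obtain ⟨m, hm⟩ := ENat.ne_top_iff_exists.1 (hρj ▸ hne)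
        have h := hcost_add j hj
        rw [← hρj, ← hm] at h
        have : m = m + b := by exact_mod_cast h
        omega
      refine hPj ⟨⟨q, hq, hqa⟩, fun r hr hra => ⟨fun n _ hnD => ?_, ?_⟩⟩
      · refine hsec j r hr (Or.inl ?_)
        change G.cost j r < G.cost j ρ
        rw [hjtop hnD.2]
        exact (QRGame.cost_le hnD.1).trans_lt (ENat.natCast_lt_top n)
      by_contra! hrT
      have hrp := QRGame.hist_inj.1 hra
      have hlate : ∀ i, (¬ ∃ t ≤ a, ρ t ∈ G.F i) → G.cost i r = ⊤ := fun i hi => by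
        refine top_le_iff.1 (QRGame.le_cost_iff.2 fun t ht => ?_)
        rcases le_total a t with hta | hta
        · exact absurd ⟨i, hi, ht⟩ (hrT t hta)
        · have h := ((hcost_late i hi).trans_le (hle i)).trans_le (QRGame.cost_le (hrp t hta ▸ ht))
          have : a + c < t := by exact_mod_cast h
          omega
      have hearly : ∀ i, (∃ t ≤ a, ρ t ∈ G.F i) → G.cost i ρ ≤ G.cost i r := fun i hi => by
        refine QRGame.le_cost_iff.2 fun t ht => ?_
        rw [← hcost_eq i hi]
        rcases le_total a t with hta | hta
        · exact (hcost_early i hi).trans (by exact_mod_cast hta)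
        · exact (hle i).trans (QRGame.cost_le (hrp t hta ▸ ht))
      refine hsec j r hr (Or.inr ⟨?_, fun i => ?_, ?_⟩)
      · change G.cost j ρ = G.cost j r
        by_cases hj : ∃ t ≤ a, ρ t ∈ G.F j
        · have hpj : G.cost j p < ((a + 1 : ℕ) : ℕ∞) := by
            refine (heq.symm.le.trans (hcost_early j hj)).trans_lt ?_
            exact_mod_cast Nat.lt_succ_self a
          obtain ⟨t, htF, ht⟩ := QRGame.cost_lt_iff.1 hpj
          have hta : t ≤ a := Nat.lt_succ_iff.1 (by exact_mod_cast ht)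
          rw [← hρj, show G.cost j ρ' = G.cost j p from heq]
          exact QRGame.cost_eq_of_agree (fun s hs => (hrp s hs).symm) ⟨t, hta, htF⟩
        · rw [hjtop hj, hlate j hj]
      · by_cases hi : ∃ t ≤ a, ρ t ∈ G.F i
        · exact hearly i hi
        · exact le_top.trans (hlate i hi).ge
      · by_contra! hcon
        refine hvisit' (Set.Subset.antisymm ?_ fun i ⟨t, _, ht⟩ => ⟨t, ht⟩)
        rintro i ⟨t, ht⟩
        by_contra hi
        have h : G.cost i r ≤ G.cost i ρ := hcon i
        rw [hlate i hi] at h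
        exact (h.trans (QRGame.cost_le ht)).not_gt (ENat.natCast_lt_top t)
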